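/- arXiv:1707.00578 — 2 statements merged into one kernel-verified Lean document; each statement's English description precedes it below -/
import Mathlib

section
/- Let g : ℝ → ℝ be twice continuously differentiable, let M > 0, and set C := sup_{|t| ≤ M} |g''(t)|. Let K ⊂ ℝ² be a nondegenerate triangle with vertices a₀, a₁, a₂ and diameter at most d, let v : ℝ² → ℝ be an affine map with |v(x)| ≤ M for all x ∈ K, and let L : ℝ² → ℝ be the unique affine map with L(a_i) = g(v(a_i)) for i = 0, 1, 2. Then |g(v(x)) − L(x)| ≤ C d² |∇v|² for every x ∈ K, where ∇v denotes the (constant) gradient of v. -/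
open scoped RealInnerProductSpace

noncomputable section

abbrev E2 : Type := EuclideanSpace ℝ (Fin 2)

end

/-- A first-order Taylor estimate on a convex set of reals where `|g''| ≤ C`. -/
theorem abs_sub_sub_deriv_mul_le {g : ℝ → ℝ} (hg : ContDiff ℝ 2 g) {S : Set ℝ}
    (hS : Convex ℝ S) {C : ℝ} (hC : ∀ r ∈ S, |iteratedDeriv 2 g r| ≤ C)
    {s t : ℝ} (hs : s ∈ S) (ht : t ∈ S) :
    |g s - g t - deriv g t * (s - t)| ≤ C * (s - t) ^ 2 := by
  have hC0 : 0 ≤ C := (abs_nonneg _).trans (hC t ht)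
  have hg1 : Differentiable ℝ g := hg.differentiable (by norm_num)
  have hg2 : Differentiable ℝ (deriv g) := by
    simpa only [iteratedDeriv_one] using hg.differentiable_iteratedDeriv 1 (by norm_num)
  have hderiv : ∀ r ∈ S, |deriv g r - deriv g t| ≤ C * |r - t| := fun r hr =>
    hS.norm_image_sub_le_of_norm_deriv_le (fun x _ => hg2 x)
      (fun x hx => by simpa [iteratedDeriv_succ] using hC x hx) ht hr
  have hsub : Set.uIcc t s ⊆ S := by
    rw [← segment_eq_uIcc]; exact hS.segment_subset ht hs
  have hmain := (convex_uIcc t s).norm_image_sub_le_of_norm_hasDerivWithin_le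
    (f := fun r => g r - deriv g t * r) (f' := fun r => deriv g r - deriv g t)
    (C := C * |s - t|)
    (fun r _ => by
      have h := (hg1 r).hasDerivAt.fun_sub ((hasDerivAt_id' r).const_mul (deriv g t))
      rw [mul_one] at h
      exact h.hasDerivWithinAt)
    (fun r hr => (hderiv r (hsub hr)).trans
      (mul_le_mul_of_nonneg_left (Set.abs_sub_left_of_mem_uIcc hr) hC0))
    Set.left_mem_uIcc Set.right_mem_uIcc
  calc |g s - g t - deriv g t * (s - t)|
      = ‖(g s - deriv g t * s) - (g t - deriv g t * t)‖ := by
        rw [Real.norm_eq_abs]; congr 1; ring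
    _ ≤ C * |s - t| * ‖s - t‖ := hmain
    _ = C * (s - t) ^ 2 := by rw [Real.norm_eq_abs, mul_assoc, abs_mul_abs_self, sq]

/-- A bound on the absolute value of an affine function extends from a set to its convex hull. -/
theorem abs_inner_add_le_of_mem_convexHull {E : Type*} [NormedAddCommGroup E]
    [InnerProductSpace ℝ E] {s : Set E} {u : E} {c B : ℝ}
    (h : ∀ y ∈ s, |⟪u, y⟫ + c| ≤ B) {x : E} (hx : x ∈ convexHull ℝ s) :
    |⟪u, x⟫ + c| ≤ B := by
  have hconv : Convex ℝ {y : E | |⟪u, y⟫ + c| ≤ B} := by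
    have hlin : IsLinearMap ℝ fun y : E => ⟪u, y⟫ := (innerₗ E u).isLinear
    convert (convex_halfSpace_ge hlin (-B - c)).inter (convex_halfSpace_le hlin (B - c)) using 1
    ext y
    simp only [Set.mem_ofPred_eq, Set.mem_inter_iff, abs_le]
    constructor <;> rintro ⟨h₁, h₂⟩ <;> constructor <;> linarith
  exact convexHull_min h hconv hx

/-- Interpolation error for `g ∘ v` on a triangle: if `g ∈ C²(ℝ)`,
`C = sup_{|t|≤M} |g''(t)|`, `K` is a nondegenerate triangle with vertices `a 0, a 1, a 2`
and diameter at most `d`, `v = ⟪bv, ·⟫ + cv` is affine with `|v| ≤ M` on `K`, and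
`L = ⟪bL, ·⟫ + cL` is the affine map interpolating `g ∘ v` at the vertices, then
`|g(v(x)) − L(x)| ≤ C d² |∇v|²` on `K`. -/
theorem statement3 (g : ℝ → ℝ) (hg : ContDiff ℝ 2 g) (M : ℝ) (hM : 0 < M)
    (C : ℝ) (hC : C = sSup ((fun t => |iteratedDeriv 2 g t|) '' Set.Icc (-M) M))
    (a : Fin 3 → E2) (ha : AffineIndependent ℝ a)
    (d : ℝ) (hd : Metric.diam (convexHull ℝ (Set.range a)) ≤ d)
    (bv : E2) (cv : ℝ)
    (hvM : ∀ x ∈ convexHull ℝ (Set.range a), |⟪bv, x⟫ + cv| ≤ M)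
    (bL : E2) (cL : ℝ)
    (hL : ∀ i : Fin 3, ⟪bL, a i⟫ + cL = g (⟪bv, a i⟫ + cv)) :
    ∀ x ∈ convexHull ℝ (Set.range a),
      |g (⟪bv, x⟫ + cv) - (⟪bL, x⟫ + cL)| ≤ C * d^2 * ‖bv‖^2 := by
  intro x hx
  have hbdd : BddAbove ((fun t => |iteratedDeriv 2 g t|) '' Set.Icc (-M) M) :=
    (isCompact_Icc.image (hg.continuous_iteratedDeriv 2 le_rfl).abs).bddAbove
  have hC2 : ∀ t ∈ Set.Icc (-M) M, |iteratedDeriv 2 g t| ≤ C := fun t ht =>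
    hC ▸ le_csSup hbdd (Set.mem_image_of_mem _ ht)
  have hC0 : 0 ≤ C := (abs_nonneg _).trans (hC2 0 ⟨by linarith, hM.le⟩)
  set t := ⟪bv, x⟫ + cv with ht
  have hvert : ∀ y ∈ Set.range a, |⟪bL - deriv g t • bv, y⟫ +
      (cL - g t - deriv g t * (cv - t))| ≤ C * d ^ 2 * ‖bv‖ ^ 2 := by
    rintro _ ⟨i, rfl⟩
    have hi : a i ∈ convexHull ℝ (Set.range a) := subset_convexHull ℝ _ ⟨i, rfl⟩
    have hdist : ‖a i - x‖ ≤ d := by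
      rw [← dist_eq_norm]
      exact (Metric.dist_le_diam_of_mem
        (isBounded_convexHull.2 (Set.finite_range a).isBounded) hi hx).trans hd
    have hdiff : |(⟪bv, a i⟫ + cv) - t| ≤ ‖bv‖ * d := by
      have hinner : (⟪bv, a i⟫ + cv) - t = ⟪bv, a i - x⟫ := by rw [ht, inner_sub_right]; ring
      rw [hinner]
      exact (abs_real_inner_le_norm _ _).trans
        (mul_le_mul_of_nonneg_left hdist (norm_nonneg _))
    have htaylor := abs_sub_sub_deriv_mul_le hg (convex_Icc (-M) M) hC2
      (abs_le.1 (hvM _ hi)) (abs_le.1 (hvM x hx))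
    calc |⟪bL - deriv g t • bv, a i⟫ + (cL - g t - deriv g t * (cv - t))|
        = |g (⟪bv, a i⟫ + cv) - g t - deriv g t * ((⟪bv, a i⟫ + cv) - t)| := by
          rw [← hL i, inner_sub_left, real_inner_smul_left]; congr 1; ring
      _ ≤ C * ((⟪bv, a i⟫ + cv) - t) ^ 2 := htaylor
      _ ≤ C * (‖bv‖ * d) ^ 2 :=
          mul_le_mul_of_nonneg_left (sq_le_sq.2 (hdiff.trans (le_abs_self _))) hC0
      _ = C * d ^ 2 * ‖bv‖ ^ 2 := by ring
  have hbound := abs_inner_add_le_of_mem_convexHull hvert hx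
  rw [abs_sub_comm]
  convert hbound using 2
  rw [inner_sub_left, real_inner_smul_left, ht]
  ring
end

section
/- Let g ∈ C²(ℝ) and M > 0. Then there exists a constant C > 0, depending only on g and M, such that for every integer h ≥ 1 and every v ∈ 𝔽_h with |v(x)| ≤ M for all x ∈ Ω̄, one has ∫_Ω |g(v(x)) − P_h(g∘v)(x)| dx ≤ C h^{−2} ∫_Ω |∇v|² dx. -/
open MeasureTheory Filter
open scoped Classical
open scoped RealInnerProductSpace

noncomputable section

/-- The point `(a, b) ∈ ℝ²`. -/
def vtx (a b : ℝ) : E2 := (WithLp.equiv 2 (Fin 2 → ℝ)).symm ![a, b]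

/-- The open unit square `Ω = (0,1)²`. -/
def Omega : Set E2 := {x | x 0 ∈ Set.Ioo (0:ℝ) 1 ∧ x 1 ∈ Set.Ioo (0:ℝ) 1}

/-- The closed unit square `Ω̄ = [0,1]²`. -/
def OmegaCl : Set E2 := {x | x 0 ∈ Set.Icc (0:ℝ) 1 ∧ x 1 ∈ Set.Icc (0:ℝ) 1}

/-- The boundary `∂Ω = Ω̄ \ Ω`. -/
def OmegaBd : Set E2 := OmegaCl \ Omega

/-- Lower-left triangle `K⁺_{k,j}` of the uniform triangulation `𝒯_h`. -/
def Kplus (h k j : ℕ) : Set E2 :=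
  {x | ((k:ℝ)-1)/h ≤ x 0 ∧ x 0 ≤ (k:ℝ)/h ∧ ((j:ℝ)-1)/h ≤ x 1 ∧
        x 1 ≤ ((j:ℝ)-1)/h + ((k:ℝ)/h - x 0)}

/-- Upper-right triangle `K⁻_{k,j}` of the uniform triangulation `𝒯_h`. -/
def Kminus (h k j : ℕ) : Set E2 :=
  {x | ((k:ℝ)-1)/h ≤ x 0 ∧ x 0 ≤ (k:ℝ)/h ∧ (j:ℝ)/h + (((k:ℝ)-1)/h - x 0) ≤ x 1 ∧
        x 1 ≤ (j:ℝ)/h}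

/-- `u` is affine on the set `S`. -/
def IsAffineOn (u : E2 → ℝ) (S : Set E2) : Prop :=
  ∃ (b : E2) (c : ℝ), ∀ x ∈ S, u x = ⟪b, x⟫ + c

/-- Membership in the finite element space `𝔽_h`: continuous on `Ω̄` and affine on every
triangle of the uniform triangulation `𝒯_h`. -/
def MemF (h : ℕ) (u : E2 → ℝ) : Prop :=
  ContinuousOn u OmegaCl ∧
  ∀ k j : ℕ, 1 ≤ k → k ≤ h → 1 ≤ j → j ≤ h →
    IsAffineOn u (Kplus h k j) ∧ IsAffineOn u (Kminus h k j)

/-- The set `Δ_h` of vertices of the triangulation `𝒯_h`. -/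
def Delta (h : ℕ) : Set E2 :=
  {x | ∃ k j : ℕ, k ≤ h ∧ j ≤ h ∧ x = vtx ((k:ℝ)/h) ((j:ℝ)/h)}

/-- The vertex `(k/h, j/h)` of `𝒯_h`. -/
def vertexPt (h k j : ℕ) : E2 := vtx ((k:ℝ)/h) ((j:ℝ)/h)

/-- `p` is the Lagrange interpolant of `f` on `𝒯_h`: `p ∈ 𝔽_h` and `p = f` on `Δ_h`. -/
def Interpolates (h : ℕ) (f p : E2 → ℝ) : Prop :=
  MemF h p ∧ ∀ x ∈ Delta h, p x = f x

/-- The Lagrange interpolation operator `P_h` (a choice of interpolant; it is unique on `Ω̄`). -/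

noncomputable def Ph (h : ℕ) (f : E2 → ℝ) : E2 → ℝ :=
  if hf : ∃ p, Interpolates h f p then hf.choose else 0

/-- Almost-everywhere defined gradient. -/
noncomputable def grad (u : E2 → ℝ) (x : E2) : E2 := gradient u x

/-- The squared `H¹(Ω)` norm `‖u‖²_{H¹} = ∫_Ω (u² + |∇u|²)`. -/
noncomputable def H1normSq (u : E2 → ℝ) : ℝ :=
  ∫ x in Omega, ((u x)^2 + ‖grad u x‖^2)

/-- The discrete phase-field energy `J_h`. -/
noncomputable def Jh (h : ℕ) (η : ℝ) (u v : E2 → ℝ) : ℝ :=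
  (1/2) * (∫ x in Omega, ((Ph h (fun y => (v y)^2) x + η) * ‖grad u x‖^2))
  + (1/2) * (∫ x in Omega, ‖grad v x‖^2)
  + (1/2) * (∫ x in Omega, Ph h (fun y => (1 - v y)^2) x)

/-- `u ∈ 𝔄_h(w)`: `u ∈ 𝔽_h` and `u = w` on `∂Ω`. -/
def MemA (h : ℕ) (w u : E2 → ℝ) : Prop :=
  MemF h u ∧ ∀ x ∈ OmegaBd, u x = w x

/-- Convergence in `𝔽_h`, i.e. with respect to the `H¹(Ω)` norm. -/
def TendstoF (u : ℕ → E2 → ℝ) (ub : E2 → ℝ) : Prop :=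
  Tendsto (fun j => H1normSq (fun y => u j y - ub y)) atTop (nhds 0)

/-- `u` minimizes `J_h(·, v)` over `𝔄_h(w)`. -/
def IsMinU (h : ℕ) (η : ℝ) (w v u : E2 → ℝ) : Prop :=
  MemA h w u ∧ ∀ u', MemA h w u' → Jh h η u v ≤ Jh h η u' v

/-- `v` minimizes `J_h(u, ·)` over `{v ∈ 𝔽_h : v ≤ vprev on Ω}`. -/
def IsMinV (h : ℕ) (η : ℝ) (u vprev v : E2 → ℝ) : Prop :=
  (MemF h v ∧ ∀ x ∈ Omega, v x ≤ vprev x) ∧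
  ∀ v', MemF h v' → (∀ x ∈ Omega, v' x ≤ vprev x) → Jh h η u v ≤ Jh h η u v'

end

lemma inner_eq_coord (b x : E2) : ⟪b, x⟫ = b 0 * x 0 + b 1 * x 1 := by
  simp [PiLp.inner_apply, Fin.sum_univ_two, mul_comm]

@[simp] lemma vtx_zero (a b : ℝ) : (vtx a b) 0 = a := by simp [vtx]

@[simp] lemma vtx_one (a b : ℝ) : (vtx a b) 1 = b := by simp [vtx]

lemma vtx_coord (x : E2) : vtx (x 0) (x 1) = x := by
  ext i
  fin_cases i <;> simp

lemma norm_sq_eq_coord (b : E2) : ‖b‖ ^ 2 = b 0 ^ 2 + b 1 ^ 2 := by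
  simp [EuclideanSpace.norm_sq_eq, Fin.sum_univ_two]

/-! ### Existence of the Lagrange interpolant -/

/-- The hat function of the lattice `ℤ²` at the origin, for the triangulation of the plane
obtained from the unit squares and their antidiagonals. -/
noncomputable def hat (s t : ℝ) : ℝ := max 0 (1 - max (max |s| |t|) |s + t|)

lemma hat_eq_zero {s t : ℝ} (h : 1 ≤ |s| ∨ 1 ≤ |t| ∨ 1 ≤ |s + t|) : hat s t = 0 := by
  have h1 : |s| ≤ max (max |s| |t|) |s + t| := (le_max_left _ _).trans (le_max_left _ _)
  have h2 : |t| ≤ max (max |s| |t|) |s + t| := (le_max_right _ _).trans (le_max_left _ _)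
  have h3 : |s + t| ≤ max (max |s| |t|) |s + t| := le_max_right _ _
  apply max_eq_left
  rcases h with h | h | h <;> linarith

lemma hat_eq_one_sub {s t r : ℝ} (hr : r ≤ 1) (h1 : |s| ≤ r) (h2 : |t| ≤ r) (h3 : |s + t| ≤ r)
    (h : r = |s| ∨ r = |t| ∨ r = |s + t|) : hat s t = 1 - r := by
  have : max (max |s| |t|) |s + t| = r := by
    apply le_antisymm (max_le (max_le h1 h2) h3)
    rcases h with h | h | h <;> simp [h]
  rw [hat, this, max_eq_right (by linarith)]

lemma one_le_abs_sub_int {s : ℝ} (h0 : 0 ≤ s) (h1 : s ≤ 1) {m : ℤ} (hm0 : m ≠ 0) (hm1 : m ≠ 1) :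
    1 ≤ |s - m| := by
  rcases (by omega : m ≤ -1 ∨ 2 ≤ m) with h | h
  · have : (m : ℝ) ≤ -1 := by exact_mod_cast h
    exact le_abs.2 (.inl (by linarith))
  · have : (2 : ℝ) ≤ m := by exact_mod_cast h
    exact le_abs.2 (.inr (by linarith))

lemma hat_int (m n : ℤ) : hat m n = if m = 0 ∧ n = 0 then 1 else 0 := by
  split_ifs with h
  · simp [hat, h.1, h.2]
  · apply hat_eq_zero
    by_cases hm : m = 0
    · exact .inr (.inl (by exact_mod_cast Int.one_le_abs (fun hn => h ⟨hm, hn⟩)))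
    · exact .inl (by exact_mod_cast Int.one_le_abs hm)

lemma hat_affine_lower (m n : ℤ) : ∃ α β γ : ℝ, ∀ s t : ℝ, 0 ≤ s → 0 ≤ t → s + t ≤ 1 →
    hat (s - m) (t - n) = α * s + β * t + γ := by
  by_cases hm : m ≠ 0 ∧ m ≠ 1
  · exact ⟨0, 0, 0, fun s t hs ht hst => by
      rw [hat_eq_zero (.inl (one_le_abs_sub_int hs (by linarith) hm.1 hm.2))]; ring⟩
  by_cases hn : n ≠ 0 ∧ n ≠ 1
  · exact ⟨0, 0, 0, fun s t hs ht hst => by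
      rw [hat_eq_zero (.inr (.inl (one_le_abs_sub_int ht (by linarith) hn.1 hn.2)))]; ring⟩
  obtain rfl | rfl : m = 0 ∨ m = 1 := by omega
  all_goals obtain rfl | rfl : n = 0 ∨ n = 1 := by omega
  · refine ⟨-1, -1, 1, fun s t hs ht hst => ?_⟩
    rw [hat_eq_one_sub (r := s + t)] <;> simp [abs_of_nonneg, *] <;> grind
  · refine ⟨0, 1, 0, fun s t hs ht hst => ?_⟩
    rw [hat_eq_one_sub (r := 1 - t)] <;> grind
  · refine ⟨1, 0, 0, fun s t hs ht hst => ?_⟩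
    rw [hat_eq_one_sub (r := 1 - s)] <;> grind
  · refine ⟨0, 0, 0, fun s t hs ht hst => ?_⟩
    rw [hat_eq_zero] <;> grind

lemma hat_affine_upper (m n : ℤ) : ∃ α β γ : ℝ, ∀ s t : ℝ, s ≤ 1 → t ≤ 1 → 1 ≤ s + t →
    hat (s - m) (t - n) = α * s + β * t + γ := by
  by_cases hm : m ≠ 0 ∧ m ≠ 1
  · exact ⟨0, 0, 0, fun s t hs ht hst => by
      rw [hat_eq_zero (.inl (one_le_abs_sub_int (by linarith) hs hm.1 hm.2))]; ring⟩
  by_cases hn : n ≠ 0 ∧ n ≠ 1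
  · exact ⟨0, 0, 0, fun s t hs ht hst => by
      rw [hat_eq_zero (.inr (.inl (one_le_abs_sub_int (by linarith) ht hn.1 hn.2)))]; ring⟩
  obtain rfl | rfl : m = 0 ∨ m = 1 := by omega
  all_goals obtain rfl | rfl : n = 0 ∨ n = 1 := by omega
  · refine ⟨0, 0, 0, fun s t hs ht hst => ?_⟩
    rw [hat_eq_zero] <;> grind
  · refine ⟨-1, 0, 1, fun s t hs ht hst => ?_⟩
    rw [hat_eq_one_sub (r := s)] <;> grind
  · refine ⟨0, -1, 1, fun s t hs ht hst => ?_⟩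
    rw [hat_eq_one_sub (r := t)] <;> grind
  · refine ⟨1, 1, -1, fun s t hs ht hst => ?_⟩
    rw [hat_eq_one_sub (r := 2 - s - t)] <;> grind

lemma isAffineOn_of_coord {u : E2 → ℝ} {S : Set E2} (α β γ : ℝ)
    (h : ∀ x ∈ S, u x = α * x 0 + β * x 1 + γ) : IsAffineOn u S :=
  ⟨vtx α β, γ, fun x hx => by rw [h x hx, inner_eq_coord, vtx_zero, vtx_one]⟩

lemma IsAffineOn.const_mul {u : E2 → ℝ} {S : Set E2} (hu : IsAffineOn u S) (a : ℝ) :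
    IsAffineOn (fun x => a * u x) S := by
  obtain ⟨b, c, h⟩ := hu
  exact ⟨a • b, a * c, fun x hx => by
    simp only [h x hx, inner_smul_left, RCLike.conj_to_real]; ring⟩

lemma isAffineOn_sum {ι : Type*} (I : Finset ι) {u : ι → E2 → ℝ} {S : Set E2}
    (hu : ∀ i ∈ I, IsAffineOn (u i) S) : IsAffineOn (fun x => ∑ i ∈ I, u i x) S := by
  choose! b c h using hu
  refine ⟨∑ i ∈ I, b i, ∑ i ∈ I, c i, fun x hx => ?_⟩
  rw [sum_inner, ← Finset.sum_add_distrib]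
  exact Finset.sum_congr rfl fun i hi => h i hi x hx

/-- The nodal basis function of `𝔽_h` at the vertex `(k/h, j/h)`. -/
noncomputable def nodal (h k j : ℕ) (x : E2) : ℝ := hat (h * x 0 - k) (h * x 1 - j)

lemma continuous_nodal (h k j : ℕ) : Continuous (nodal h k j) := by
  unfold nodal hat
  fun_prop

lemma nodal_isAffineOn_Kplus {h : ℕ} (hh : 1 ≤ h) (k j m n : ℕ) :
    IsAffineOn (nodal h m n) (Kplus h k j) := by
  have hpos : (0 : ℝ) < h := by exact_mod_cast hh
  obtain ⟨α, β, γ, H⟩ := hat_affine_lower ((m : ℤ) - (k - 1)) ((n : ℤ) - (j - 1))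
  refine isAffineOn_of_coord (α * h) (β * h) (γ - α * (k - 1) - β * (j - 1)) ?_
  rintro x ⟨h1, -, h3, h4⟩
  have h1' : (k : ℝ) - 1 ≤ h * x 0 := by rwa [div_le_iff₀' hpos] at h1
  have h3' : (j : ℝ) - 1 ≤ h * x 1 := by rwa [div_le_iff₀' hpos] at h3
  have h4' : h * x 1 ≤ (j - 1) + (k - h * x 0) := by
    have := mul_le_mul_of_nonneg_left h4 hpos.le
    field_simp at this
    linarith
  have := H (h * x 0 - (k - 1)) (h * x 1 - (j - 1)) (by linarith) (by linarith) (by linarith)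
  push_cast at this
  rw [nodal, show α * h * x 0 + β * h * x 1 + (γ - α * (k - 1) - β * (j - 1)) =
    α * (h * x 0 - (k - 1)) + β * (h * x 1 - (j - 1)) + γ by ring, ← this]
  congr 1 <;> ring

lemma nodal_isAffineOn_Kminus {h : ℕ} (hh : 1 ≤ h) (k j m n : ℕ) :
    IsAffineOn (nodal h m n) (Kminus h k j) := by
  have hpos : (0 : ℝ) < h := by exact_mod_cast hh
  obtain ⟨α, β, γ, H⟩ := hat_affine_upper ((m : ℤ) - (k - 1)) ((n : ℤ) - (j - 1))
  refine isAffineOn_of_coord (α * h) (β * h) (γ - α * (k - 1) - β * (j - 1)) ?_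
  rintro x ⟨-, h2, h3, h4⟩
  have h2' : h * x 0 ≤ k := by rwa [le_div_iff₀' hpos] at h2
  have h4' : h * x 1 ≤ j := by rwa [le_div_iff₀' hpos] at h4
  have h3' : j + ((k - 1) - h * x 0) ≤ h * x 1 := by
    have := mul_le_mul_of_nonneg_left h3 hpos.le
    field_simp at this
    linarith
  have := H (h * x 0 - (k - 1)) (h * x 1 - (j - 1)) (by linarith) (by linarith) (by linarith)
  push_cast at this
  rw [nodal, show α * h * x 0 + β * h * x 1 + (γ - α * (k - 1) - β * (j - 1)) =
    α * (h * x 0 - (k - 1)) + β * (h * x 1 - (j - 1)) + γ by ring, ← this]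
  congr 1 <;> ring

lemma nodal_vertexPt {h : ℕ} (hh : 1 ≤ h) (k j m n : ℕ) :
    nodal h m n (vertexPt h k j) = if k = m ∧ j = n then 1 else 0 := by
  have hne : (h : ℝ) ≠ 0 := by positivity
  have := hat_int ((k : ℤ) - m) ((j : ℤ) - n)
  push_cast at this
  rw [nodal, vertexPt, vtx_zero, vtx_one, mul_div_cancel₀ _ hne, mul_div_cancel₀ _ hne, this]
  congr 1
  simp only [eq_iff_iff]
  omega

lemma exists_interpolates {h : ℕ} (hh : 1 ≤ h) (f : E2 → ℝ) : ∃ p, Interpolates h f p := by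
  let I := Finset.range (h + 1) ×ˢ Finset.range (h + 1)
  refine ⟨fun x => ∑ i ∈ I, f (vertexPt h i.1 i.2) * nodal h i.1 i.2 x, ⟨?_, ?_⟩, ?_⟩
  · exact (continuous_finsetSum _ fun i _ =>
      continuous_const.mul (continuous_nodal h i.1 i.2)).continuousOn
  · intro k j _ _ _ _
    exact ⟨isAffineOn_sum I fun i _ => (nodal_isAffineOn_Kplus hh k j i.1 i.2).const_mul _,
      isAffineOn_sum I fun i _ => (nodal_isAffineOn_Kminus hh k j i.1 i.2).const_mul _⟩
  · rintro _ ⟨k, j, hk, hj, rfl⟩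
    change ∑ i ∈ I, f (vertexPt h i.1 i.2) * nodal h i.1 i.2 (vertexPt h k j) =
      f (vertexPt h k j)
    rw [Finset.sum_eq_single (k, j)]
    · simp [nodal_vertexPt hh]
    · rintro ⟨m, n⟩ - hne
      rw [nodal_vertexPt hh, if_neg, mul_zero]
      rintro ⟨rfl, rfl⟩
      exact hne rfl
    · intro hnot
      exact absurd (by simp [I]; omega) hnot

lemma Ph_interpolates {h : ℕ} (hh : 1 ≤ h) (f : E2 → ℝ) : Interpolates h f (Ph h f) := by
  have hex := exists_interpolates hh f
  rw [Ph, dif_pos hex]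
  exact hex.choose_spec

/-! ### The error estimate on one triangle -/

/-- First-order Taylor estimate, with a uniform constant on a bounded interval. -/
lemma exists_taylor_bound {g : ℝ → ℝ} (hg : ContDiff ℝ 2 g) (M : ℝ) :
    ∃ L : ℝ, 0 < L ∧ ∀ x ∈ Set.Icc (-M) M, ∀ y ∈ Set.Icc (-M) M,
      |g y - g x - deriv g x * (y - x)| ≤ L * (y - x) ^ 2 := by
  have hg' : ContDiff ℝ 1 (deriv g) := hg.deriv'
  have hd : Differentiable ℝ g := hg.differentiable (by norm_num)
  have hd' : Differentiable ℝ (deriv g) := hg'.differentiable (by norm_num)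
  obtain ⟨L, hL⟩ := isCompact_Icc.exists_bound_of_continuousOn
    (s := Set.Icc (-M) M) (hg'.continuous_deriv le_rfl).continuousOn
  refine ⟨max L 1, by positivity, fun x hx y hy => ?_⟩
  have hsub : Set.uIcc x y ⊆ Set.Icc (-M) M := Set.ordConnected_Icc.uIcc_subset hx hy
  have key : ∀ z ∈ Set.uIcc x y, ‖deriv g z - deriv g x‖ ≤ max L 1 * |y - x| := by
    intro z hz
    have := (convex_Icc (-M) M).norm_image_sub_le_of_norm_deriv_le
      (fun w _ => hd' w) (fun w hw => (hL w hw).trans (le_max_left L 1)) hx (hsub hz)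
    refine this.trans (mul_le_mul_of_nonneg_left ?_ (by positivity))
    exact Set.abs_sub_left_of_mem_uIcc hz
  have := (convex_uIcc x y).norm_image_sub_le_of_norm_hasDerivWithin_le
    (f := fun z => g z - deriv g x * z) (f' := fun z => deriv g z - deriv g x)
    (fun z _ => by
      have := (hd z).hasDerivAt.sub ((hasDerivAt_id z).const_mul (deriv g x))
      rw [mul_one] at this
      exact this.hasDerivWithinAt)
    key Set.left_mem_uIcc Set.right_mem_uIcc
  rw [Real.norm_eq_abs, Real.norm_eq_abs, mul_assoc, ← sq, sq_abs] at this
  convert this using 2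
  ring

/-- Values of `g` compared with the affine interpolation on three points, using only a quadratic
Taylor bound for `g`. -/
lemma abs_sub_convexComb_le {g : ℝ → ℝ} {M L D : ℝ}
    (hL0 : 0 ≤ L) (hL : ∀ x ∈ Set.Icc (-M) M, ∀ y ∈ Set.Icc (-M) M,
      |g y - g x - deriv g x * (y - x)| ≤ L * (y - x) ^ 2)
    {a : ℝ} {w y : Fin 3 → ℝ} (hw : ∀ i, 0 ≤ w i) (hw1 : ∑ i, w i = 1)
    (ha : a = ∑ i, w i * y i) (haM : a ∈ Set.Icc (-M) M) (hy : ∀ i, y i ∈ Set.Icc (-M) M)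
    (hD : ∀ i, (y i - a) ^ 2 ≤ D) :
    |g a - ∑ i, w i * g (y i)| ≤ L * D := by
  have e : g a - ∑ i, w i * g (y i) =
      -∑ i, w i * (g (y i) - g a - deriv g a * (y i - a)) := by
    have h1 : ∑ i, w i * (g (y i) - g a - deriv g a * (y i - a)) =
        ∑ i, w i * g (y i) - g a * ∑ i, w i - deriv g a * (∑ i, w i * y i - a * ∑ i, w i) := by
      simp only [Finset.mul_sum, ← Finset.sum_sub_distrib]
      exact Finset.sum_congr rfl fun i _ => by ring
    rw [h1, ← ha, hw1]
    ring
  rw [e, abs_neg]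
  calc _ ≤ ∑ i, |w i * (g (y i) - g a - deriv g a * (y i - a))| := Finset.abs_sum_le_sum_abs _ _
    _ ≤ ∑ i, w i * (L * D) := by
        refine Finset.sum_le_sum fun i _ => ?_
        rw [abs_mul, abs_of_nonneg (hw i)]
        exact mul_le_mul_of_nonneg_left
          ((hL a haM _ (hy i)).trans (mul_le_mul_of_nonneg_left (hD i) hL0)) (hw i)
    _ = L * D := by rw [← Finset.sum_mul, hw1, one_mul]

/-- The error estimate on a right triangle with legs parallel to the axes, of signed length `δ`. -/
lemma triangle_estimate {g : ℝ → ℝ} {M L : ℝ}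
    (hL0 : 0 ≤ L) (hL : ∀ x ∈ Set.Icc (-M) M, ∀ y ∈ Set.Icc (-M) M,
      |g y - g x - deriv g x * (y - x)| ≤ L * (y - x) ^ 2)
    {S : Set E2} {v p : E2 → ℝ} {b : E2} {c : ℝ} (hv : ∀ x ∈ S, v x = ⟪b, x⟫ + c)
    (hp : IsAffineOn p S) (hM : ∀ x ∈ S, |v x| ≤ M) {q r δ s t : ℝ}
    (hs : 0 ≤ s) (ht : 0 ≤ t) (hst : s + t ≤ 1)
    (hx : vtx (q + δ * s) (r + δ * t) ∈ S)
    (h0 : vtx q r ∈ S) (h1 : vtx (q + δ) r ∈ S) (h2 : vtx q (r + δ) ∈ S)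
    (hp0 : p (vtx q r) = g (v (vtx q r)))
    (hp1 : p (vtx (q + δ) r) = g (v (vtx (q + δ) r)))
    (hp2 : p (vtx q (r + δ)) = g (v (vtx q (r + δ)))) :
    |g (v (vtx (q + δ * s) (r + δ * t))) - p (vtx (q + δ * s) (r + δ * t))|
        ≤ 2 * L * δ ^ 2 * ‖b‖ ^ 2 ∧
      δ ^ 2 * ‖b‖ ^ 2 ≤ 8 * M ^ 2 := by
  have bary : ∀ {u : E2 → ℝ} {b : E2} {c : ℝ}, (∀ x ∈ S, u x = ⟪b, x⟫ + c) →
      u (vtx (q + δ * s) (r + δ * t)) =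
        (1 - s - t) * u (vtx q r) + s * u (vtx (q + δ) r) + t * u (vtx q (r + δ)) := by
    intro u b c hu
    rw [hu _ hx, hu _ h0, hu _ h1, hu _ h2]
    simp only [inner_eq_coord, vtx_zero, vtx_one]
    ring
  obtain ⟨b', c', hp'⟩ := hp
  have e1 : v (vtx (q + δ) r) = v (vtx q r) + δ * b 0 := by
    rw [hv _ h1, hv _ h0]; simp only [inner_eq_coord, vtx_zero, vtx_one]; ring
  have e2 : v (vtx q (r + δ)) = v (vtx q r) + δ * b 1 := by
    rw [hv _ h2, hv _ h0]; simp only [inner_eq_coord, vtx_zero, vtx_one]; ring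
  have m0 := abs_le.1 (hM _ h0)
  have m1 := abs_le.1 (hM _ h1)
  have m2 := abs_le.1 (hM _ h2)
  refine ⟨?_, ?_⟩
  · have hb := bary hv
    have := abs_sub_convexComb_le (D := 2 * (δ ^ 2 * ‖b‖ ^ 2)) hL0 hL
      (a := v (vtx (q + δ * s) (r + δ * t))) (w := ![1 - s - t, s, t])
      (y := ![v (vtx q r), v (vtx (q + δ) r), v (vtx q (r + δ))])
      (by intro i; fin_cases i <;> simp <;> linarith)
      (by simp [Fin.sum_univ_three]; ring)
      (by simpa [Fin.sum_univ_three] using hb)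
      (abs_le.1 (hM _ hx))
      (by intro i; fin_cases i <;> simp <;> constructor <;> linarith)
      (by
        have key : ∀ σ τ : ℝ, |σ| ≤ 1 → |τ| ≤ 1 →
            (δ * b 0 * σ + δ * b 1 * τ) ^ 2 ≤ 2 * (δ ^ 2 * ‖b‖ ^ 2) := by
          intro σ τ hσ hτ
          have hσ' := mul_le_mul_of_nonneg_left ((sq_le_one_iff_abs_le_one σ).2 hσ)
            (sq_nonneg (δ * b 0))
          have hτ' := mul_le_mul_of_nonneg_left ((sq_le_one_iff_abs_le_one τ).2 hτ)
            (sq_nonneg (δ * b 1))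
          rw [norm_sq_eq_coord]
          nlinarith [sq_nonneg (δ * b 0 * σ - δ * b 1 * τ)]
        rw [hb, e1, e2]
        intro i
        fin_cases i
        · convert key (-s) (-t) (by grind) (by grind) using 2
          simp; ring
        · convert key (1 - s) (-t) (by grind) (by grind) using 2
          simp; ring
        · convert key (-s) (1 - t) (by grind) (by grind) using 2
          simp; ring)
    rw [bary hp', hp0, hp1, hp2]
    simp only [Fin.sum_univ_three, Matrix.cons_val_zero, Matrix.cons_val_one,
      Matrix.cons_val] at this
    linarith
  · rw [norm_sq_eq_coord]
    have k1 : (δ * b 0) ^ 2 ≤ (2 * M) ^ 2 := sq_le_sq' (by linarith) (by linarith)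
    have k2 : (δ * b 1) ^ 2 ≤ (2 * M) ^ 2 := sq_le_sq' (by linarith) (by linarith)
    nlinarith

lemma grad_eq_of_mem_nhds {v : E2 → ℝ} {S : Set E2} {x b : E2} {c : ℝ}
    (hv : ∀ y ∈ S, v y = ⟪b, y⟫ + c) (hS : S ∈ nhds x) : grad v x = b := by
  have h : HasGradientAt (fun y : E2 => ⟪b, y⟫ + c) b x := by
    rw [hasGradientAt_iff_hasFDerivAt]
    exact (innerSL ℝ b).hasFDerivAt.add_const c
  have h' := h.congr_of_eventuallyEq (f₁ := v) (Filter.mem_of_superset hS hv)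
  exact h'.gradient

/-! ### The estimate almost everywhere -/

lemma volume_level_eq_zero {ℓ : E2 →ₗ[ℝ] ℝ} (hℓ : ℓ ≠ 0) (c : ℝ) :
    volume {x : E2 | ℓ x = c} = 0 := by
  rcases Set.eq_empty_or_nonempty {x : E2 | ℓ x = c} with h | ⟨y, hy⟩
  · simp [h]
  have e : {x : E2 | ℓ x = c} = (fun x => x + -y) ⁻¹' (LinearMap.ker ℓ : Set E2) := by
    ext x
    have hy' : ℓ y = c := hy
    simp [hy', ← sub_eq_add_neg, sub_eq_zero]
  rw [e, measure_preimage_add_right]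
  exact Measure.addHaar_submodule volume _ (by rwa [ne_eq, LinearMap.ker_eq_top])

lemma ae_ne_int {ℓ : E2 →ₗ[ℝ] ℝ} (hℓ : ℓ ≠ 0) : ∀ᵐ x : E2, ∀ n : ℤ, ℓ x ≠ n := by
  rw [ae_all_iff]
  intro n
  simpa [ae_iff] using volume_level_eq_zero hℓ n

lemma ae_off_skeleton {h : ℕ} (hh : 1 ≤ h) : ∀ᵐ x : E2, ∀ n : ℤ,
    h * x 0 ≠ n ∧ h * x 1 ≠ n ∧ h * x 0 + h * x 1 ≠ n := by
  have hne : (h : ℝ) ≠ 0 := by positivity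
  let π : Fin 2 → E2 →ₗ[ℝ] ℝ := fun i => (EuclideanSpace.proj (𝕜 := ℝ) i).toLinearMap
  have h1 : (h : ℝ) • π 0 ≠ 0 := fun H => hne (by
    simpa [π] using LinearMap.congr_fun H (vtx 1 0))
  have h2 : (h : ℝ) • π 1 ≠ 0 := fun H => hne (by
    simpa [π] using LinearMap.congr_fun H (vtx 0 1))
  have h3 : (h : ℝ) • π 0 + (h : ℝ) • π 1 ≠ 0 := fun H => hne (by
    simpa [π] using LinearMap.congr_fun H (vtx 1 0))
  filter_upwards [ae_ne_int h1, ae_ne_int h2, ae_ne_int h3] with x a1 a2 a3 n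
  exact ⟨a1 n, a2 n, a3 n⟩

lemma Kplus_subset_OmegaCl {h k j : ℕ} (hh : 1 ≤ h) (hk : 1 ≤ k) (hk' : k ≤ h) (hj : 1 ≤ j) (hj' : j ≤ h) :
    Kplus h k j ⊆ OmegaCl := by
  have hpos : (0 : ℝ) < h := by exact_mod_cast hh
  have a1 : (0 : ℝ) ≤ ((k : ℝ) - 1) / h := by
    have : (1 : ℝ) ≤ k := by exact_mod_cast hk
    exact div_nonneg (by linarith) hpos.le
  have a2 : (0 : ℝ) ≤ ((j : ℝ) - 1) / h := by
    have : (1 : ℝ) ≤ j := by exact_mod_cast hj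
    exact div_nonneg (by linarith) hpos.le
  have a3 : (k : ℝ) / h ≤ 1 := (div_le_one hpos).2 (by exact_mod_cast hk')
  have a4 : (j : ℝ) / h ≤ 1 := (div_le_one hpos).2 (by exact_mod_cast hj')
  rintro x ⟨h1, h2, h3, h4⟩
  rw [sub_div] at h1 h3 h4 a1 a2
  exact ⟨⟨by linarith, by linarith⟩, ⟨by linarith, by linarith⟩⟩

lemma Kminus_subset_OmegaCl {h k j : ℕ} (hh : 1 ≤ h) (hk : 1 ≤ k) (hk' : k ≤ h) (hj : 1 ≤ j)
    (hj' : j ≤ h) : Kminus h k j ⊆ OmegaCl := by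
  have hpos : (0 : ℝ) < h := by exact_mod_cast hh
  have a1 : (0 : ℝ) ≤ ((k : ℝ) - 1) / h := by
    have : (1 : ℝ) ≤ k := by exact_mod_cast hk
    exact div_nonneg (by linarith) hpos.le
  have a2 : (0 : ℝ) ≤ ((j : ℝ) - 1) / h := by
    have : (1 : ℝ) ≤ j := by exact_mod_cast hj
    exact div_nonneg (by linarith) hpos.le
  have a3 : (k : ℝ) / h ≤ 1 := (div_le_one hpos).2 (by exact_mod_cast hk')
  have a4 : (j : ℝ) / h ≤ 1 := (div_le_one hpos).2 (by exact_mod_cast hj')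
  rintro x ⟨h1, h2, h3, h4⟩
  rw [sub_div] at h1 h3 a1 a2
  exact ⟨⟨by linarith, by linarith⟩, ⟨by linarith, by linarith⟩⟩

lemma pointwise_estimate {g : ℝ → ℝ} {M L : ℝ}
    (hL0 : 0 ≤ L) (hL : ∀ x ∈ Set.Icc (-M) M, ∀ y ∈ Set.Icc (-M) M,
      |g y - g x - deriv g x * (y - x)| ≤ L * (y - x) ^ 2)
    {h : ℕ} (hh : 1 ≤ h) {v p : E2 → ℝ} (hv : MemF h v)
    (hp : Interpolates h (fun y => g (v y)) p) (hM : ∀ x ∈ OmegaCl, |v x| ≤ M) {x : E2}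
    (hx : x ∈ Omega) (hgen : ∀ n : ℤ, h * x 0 ≠ n ∧ h * x 1 ≠ n ∧ h * x 0 + h * x 1 ≠ n) :
    |g (v x) - p x| ≤ 2 * L / (h : ℝ) ^ 2 * ‖grad v x‖ ^ 2 ∧
      ‖grad v x‖ ^ 2 ≤ 8 * M ^ 2 * (h : ℝ) ^ 2 := by
  have hpos : (0 : ℝ) < h := by exact_mod_cast hh
  obtain ⟨⟨x0, x0'⟩, x1, x1'⟩ := hx
  set m := ⌊h * x 0⌋₊ with hm
  set n := ⌊h * x 1⌋₊ with hn
  have m1 : (m : ℝ) < h * x 0 := lt_of_le_of_ne (Nat.floor_le (by positivity))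
    fun H => (hgen m).1 (by exact_mod_cast H.symm)
  have m2 : h * x 0 < m + 1 := Nat.lt_floor_add_one _
  have n1 : (n : ℝ) < h * x 1 := lt_of_le_of_ne (Nat.floor_le (by positivity))
    fun H => (hgen n).2.1 (by exact_mod_cast H.symm)
  have n2 : h * x 1 < n + 1 := Nat.lt_floor_add_one _
  have mh : m + 1 ≤ h := by
    have : (m : ℝ) < h := by nlinarith
    exact_mod_cast this
  have nh : n + 1 ≤ h := by
    have : (n : ℝ) < h := by nlinarith
    exact_mod_cast this
  have fin : ∀ {b : E2} {δ : ℝ}, δ ^ 2 = 1 / (h : ℝ) ^ 2 → grad v x = b →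
      (|g (v x) - p x| ≤ 2 * L * δ ^ 2 * ‖b‖ ^ 2 ∧ δ ^ 2 * ‖b‖ ^ 2 ≤ 8 * M ^ 2) →
      |g (v x) - p x| ≤ 2 * L / (h : ℝ) ^ 2 * ‖grad v x‖ ^ 2 ∧
        ‖grad v x‖ ^ 2 ≤ 8 * M ^ 2 * (h : ℝ) ^ 2 := by
    rintro b δ hδ rfl ⟨q1, q2⟩
    rw [hδ] at q1 q2
    refine ⟨by rwa [mul_one_div] at q1, ?_⟩
    rwa [one_div_mul_eq_div, div_le_iff₀ (by positivity)] at q2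
  have hc0 : Continuous fun y : E2 => y 0 := by fun_prop
  have hc1 : Continuous fun y : E2 => y 1 := by fun_prop
  have hpm : ((m : ℝ) + 1) / h = m / h + 1 / h := by ring
  have hpn : ((n : ℝ) + 1) / h = n / h + 1 / h := by ring
  have hi : 0 < 1 / (h : ℝ) := by positivity
  have vert : ∀ k j : ℕ, k ≤ h → j ≤ h →
      p (vtx ((k : ℝ) / h) ((j : ℝ) / h)) = g (v (vtx ((k : ℝ) / h) ((j : ℝ) / h))) :=
    fun k j hk hj => hp.2 _ ⟨k, j, hk, hj, rfl⟩
  have v00 := vert m n (by omega) (by omega)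
  have v10 := vert (m + 1) n (by omega) (by omega)
  have v01 := vert m (n + 1) (by omega) (by omega)
  have v11 := vert (m + 1) (n + 1) (by omega) (by omega)
  push_cast at v10 v01 v11
  have A := hv.2 (m + 1) (n + 1) (by omega) mh (by omega) nh
  have B := hp.1.2 (m + 1) (n + 1) (by omega) mh (by omega) nh
  have m1' : (m : ℝ) / h < x 0 := by rwa [div_lt_iff₀' hpos]
  have m2' : x 0 < ((m : ℝ) + 1) / h := by rwa [lt_div_iff₀' hpos]
  have n1' : (n : ℝ) / h < x 1 := by rwa [div_lt_iff₀' hpos]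
  have n2' : x 1 < ((n : ℝ) + 1) / h := by rwa [lt_div_iff₀' hpos]
  rcases lt_or_gt_of_ne (fun H : h * x 0 + h * x 1 = m + n + 1 =>
    (hgen (m + n + 1)).2.2 (by push_cast; exact H)) with hlt | hgt
  · have d : x 1 < (n : ℝ) / h + (((m : ℝ) + 1) / h - x 0) := by
      have : x 0 + x 1 < (m + n + 1) / h := by
        rw [lt_div_iff₀' hpos]; linarith
      have e : ((m : ℝ) + n + 1) / h = n / h + (m + 1) / h := by ring
      linarith
    have mem : ∀ y : E2, y ∈ Kplus h (m + 1) (n + 1) ↔ (m : ℝ) / h ≤ y 0 ∧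
        y 0 ≤ ((m : ℝ) + 1) / h ∧ (n : ℝ) / h ≤ y 1 ∧
        y 1 ≤ (n : ℝ) / h + (((m : ℝ) + 1) / h - y 0) := by
      intro y; simp [Kplus]
    obtain ⟨b, c, hb⟩ := A.1
    have nb : Kplus h (m + 1) (n + 1) ∈ nhds x := by
      filter_upwards [hc0.continuousAt.eventually_const_lt m1', hc0.continuousAt.eventually_lt_const m2',
        hc1.continuousAt.eventually_const_lt n1', hc1.continuousAt.eventually_lt
          (continuousAt_const.add (continuousAt_const.sub hc0.continuousAt)) d] with y a1 a2 a3 a4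
      exact (mem y).2 ⟨a1.le, a2.le, a3.le, a4.le⟩
    have xe : vtx ((m : ℝ) / h + 1 / h * (h * x 0 - m)) ((n : ℝ) / h + 1 / h * (h * x 1 - n)) = x := by
      rw [← vtx_coord x]
      congr 1 <;> simp <;> field_simp <;> ring
    have est := triangle_estimate (δ := 1 / (h : ℝ)) (q := m / h) (r := n / h)
      (s := h * x 0 - m) (t := h * x 1 - n) hL0 hL hb B.1
      (fun y hy => hM y (Kplus_subset_OmegaCl hh (by omega) mh (by omega) nh hy))
      (by linarith) (by linarith) (by linarith) (by rw [xe]; exact mem_of_mem_nhds nb)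
      ((mem _).2 (by simp only [vtx_zero, vtx_one]; refine ⟨?_, ?_, ?_, ?_⟩ <;> linarith))
      ((mem _).2 (by simp only [vtx_zero, vtx_one]; refine ⟨?_, ?_, ?_, ?_⟩ <;> linarith))
      ((mem _).2 (by simp only [vtx_zero, vtx_one]; refine ⟨?_, ?_, ?_, ?_⟩ <;> linarith))
      v00 (by rw [← hpm]; exact v10) (by rw [← hpn]; exact v01)
    rw [xe] at est
    exact fin (by ring) (grad_eq_of_mem_nhds hb nb) est
  · have d : ((n : ℝ) + 1) / h + ((m : ℝ) / h - x 0) < x 1 := by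
      have : (m + n + 1) / h < x 0 + x 1 := by
        rw [div_lt_iff₀' hpos]; linarith
      have e : ((m : ℝ) + n + 1) / h = (n + 1) / h + m / h := by ring
      linarith
    have mem : ∀ y : E2, y ∈ Kminus h (m + 1) (n + 1) ↔ (m : ℝ) / h ≤ y 0 ∧
        y 0 ≤ ((m : ℝ) + 1) / h ∧ ((n : ℝ) + 1) / h + ((m : ℝ) / h - y 0) ≤ y 1 ∧
        y 1 ≤ ((n : ℝ) + 1) / h := by
      intro y; simp [Kminus]
    obtain ⟨b, c, hb⟩ := A.2
    have nb : Kminus h (m + 1) (n + 1) ∈ nhds x := by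
      filter_upwards [hc0.continuousAt.eventually_const_lt m1', hc0.continuousAt.eventually_lt_const m2',
        hc1.continuousAt.eventually_lt_const n2', ContinuousAt.eventually_lt
          (continuousAt_const.add (continuousAt_const.sub hc0.continuousAt))
          hc1.continuousAt d] with y a1 a2 a3 a4
      exact (mem y).2 ⟨a1.le, a2.le, a4.le, a3.le⟩
    have xe : vtx (((m : ℝ) + 1) / h + -(1 / h) * (m + 1 - h * x 0))
        (((n : ℝ) + 1) / h + -(1 / h) * (n + 1 - h * x 1)) = x := by
      rw [← vtx_coord x]
      congr 1 <;> simp <;> field_simp <;> ring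
    have hmm : ((m : ℝ) + 1) / h + -(1 / h) = m / h := by ring
    have hnn : ((n : ℝ) + 1) / h + -(1 / h) = n / h := by ring
    have est := triangle_estimate (δ := -(1 / (h : ℝ))) (q := (m + 1) / h) (r := (n + 1) / h)
      (s := m + 1 - h * x 0) (t := n + 1 - h * x 1) hL0 hL hb B.2
      (fun y hy => hM y (Kminus_subset_OmegaCl hh (by omega) mh (by omega) nh hy))
      (by linarith) (by linarith) (by linarith) (by rw [xe]; exact mem_of_mem_nhds nb)
      ((mem _).2 (by simp only [vtx_zero, vtx_one]; refine ⟨?_, ?_, ?_, ?_⟩ <;> linarith))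
      ((mem _).2 (by simp only [vtx_zero, vtx_one]; refine ⟨?_, ?_, ?_, ?_⟩ <;> linarith))
      ((mem _).2 (by simp only [vtx_zero, vtx_one]; refine ⟨?_, ?_, ?_, ?_⟩ <;> linarith))
      v11 (by rw [hmm]; exact v01) (by rw [hnn]; exact v10)
    rw [xe] at est
    exact fin (by ring) (grad_eq_of_mem_nhds hb nb) est

lemma norm_grad (u : E2 → ℝ) (x : E2) : ‖grad u x‖ = ‖fderiv ℝ u x‖ := by
  simp [grad, gradient]

lemma measurableSet_Omega : MeasurableSet Omega := by
  have h0 : Measurable fun x : E2 => x 0 := by fun_prop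
  have h1 : Measurable fun x : E2 => x 1 := by fun_prop
  exact (h0 measurableSet_Ioo).inter (h1 measurableSet_Ioo)

lemma volume_Omega_lt_top : volume Omega < ⊤ := by
  refine lt_of_le_of_lt (measure_mono (t := Metric.closedBall 0 2) fun x hx => ?_)
    measure_closedBall_lt_top
  obtain ⟨⟨a, b⟩, c, d⟩ := hx
  rw [mem_closedBall_zero_iff]
  refine abs_le_of_sq_le_sq' ?_ (by norm_num) |>.2
  rw [norm_sq_eq_coord]
  nlinarith

/-- (Lemma on the interpolation operator `P_h`.) For `g ∈ C²(ℝ)` and `M > 0`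
there is `C = C(g, M) > 0` such that for all `h ≥ 1` and all `v ∈ 𝔽_h` with `|v| ≤ M` on `Ω̄`,
`‖(g ∘ v) − P_h(g ∘ v)‖_{L¹(Ω)} ≤ C h⁻² ‖∇v‖²_{L²(Ω)}`. -/
theorem statement4 (g : ℝ → ℝ) (hg : ContDiff ℝ 2 g) (M : ℝ) (hM : 0 < M) :
    ∃ C : ℝ, 0 < C ∧ ∀ h : ℕ, 1 ≤ h → ∀ v : E2 → ℝ, MemF h v →
      (∀ x ∈ OmegaCl, |v x| ≤ M) →
      (∫ x in Omega, |g (v x) - Ph h (fun y => g (v y)) x|)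
        ≤ C / (h:ℝ)^2 * ∫ x in Omega, ‖grad v x‖^2 := by
  obtain ⟨L, hL0, hL⟩ := exists_taylor_bound hg M
  refine ⟨2 * L, by positivity, fun h hh v hv hvM => ?_⟩
  have key : ∀ᵐ x ∂volume.restrict Omega,
      |g (v x) - Ph h (fun y => g (v y)) x| ≤ 2 * L / (h : ℝ) ^ 2 * ‖grad v x‖ ^ 2 ∧
        ‖grad v x‖ ^ 2 ≤ 8 * M ^ 2 * (h : ℝ) ^ 2 := by
    filter_upwards [ae_restrict_mem measurableSet_Omega, ae_restrict_of_ae (ae_off_skeleton hh)]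
      with x hx hgen
    exact pointwise_estimate hL0.le hL hh hv (Ph_interpolates hh _) hvM hx hgen
  have hmeas : Measurable fun x => ‖grad v x‖ ^ 2 := by
    simp only [norm_grad]
    exact (measurable_fderiv ℝ v).norm.pow_const 2
  have hint : IntegrableOn (fun x => ‖grad v x‖ ^ 2) Omega :=
    Measure.integrableOn_of_bounded volume_Omega_lt_top.ne hmeas.aestronglyMeasurable
      (M := 8 * M ^ 2 * (h : ℝ) ^ 2)
      (key.mono fun x hx => by rw [Real.norm_of_nonneg (by positivity)]; exact hx.2)
  rw [← integral_const_mul]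
  exact integral_mono_of_nonneg (ae_of_all _ fun x => abs_nonneg _) (hint.const_mul _)
    (key.mono fun x hx => hx.1)
end
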